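/- Let K be an uncountable algebraically closed field of characteristic 0, let d ≥ 1, and let L ⊆ Sym^d be a K-subspace with 3 ≤ finrank_K L which has degree d and arithmetic genus g ≥ 1 (i.e. finrank_K(L^k) = d·k + 1 − g for all sufficiently large k). Then there exists Q = (α, β) ∈ K × K with (α, β) ≠ (0, 0) such that the value semigroup S(L, Q) is NOT finitely generated; that is, R(L) is not homogeneously Khovanskii-finite. (Converse part of Theorem 4.11 of the paper; equivalently, the nontrivial direction of Theorem 1.3: over an uncountable algebraically closed field of characteristic 0, the affine cone over a singular projective integral rational curve is not homogeneously Khovanskii-finite.) -/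

import Mathlib

open MvPolynomial Filter

noncomputable section

variable {K : Type} [Field K]

/-- The linear form `β·s − α·t` in `K[s,t]`, cutting out the point `Q = (α : β)` of `ℙ¹`. -/
def lform (α β : K) : MvPolynomial (Fin 2) K := C β * X 0 - C α * X 1

/-- The value semigroup `S(L, Q) = {(k, ord_Q f) : f ∈ L^k, f ≠ 0}` of the homogeneous
valuation `ν_Q` on `R(L) = ⨁ₖ L^k`, where `ord_Q f` is the largest `e` such that
`(β·s − α·t)^e` divides `f`. -/
def curveValueSemigroup (L : Submodule K (MvPolynomial (Fin 2) K)) (α β : K) :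
    AddSubmonoid (ℤ × ℤ) :=
  AddSubmonoid.closure
    {p | ∃ (k e : ℕ) (f : MvPolynomial (Fin 2) K), f ∈ L ^ k ∧ f ≠ 0 ∧
      (lform α β) ^ e ∣ f ∧ ¬ (lform α β) ^ (e + 1) ∣ f ∧ p = ((k : ℤ), (e : ℤ))}

theorem lform_isHomogeneous (α β : K) : (lform α β).IsHomogeneous 1 :=
  (isHomogeneous_C_mul_X β 0).sub (isHomogeneous_C_mul_X α 1)

theorem lform_one_ne_zero (α : K) : lform α 1 ≠ 0 := by
  intro h
  have := congrArg (MvPolynomial.eval ![(1 : K), 0]) h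
  simp [lform] at this

/-- The monomials `s^(n-i) t^i`, for `0 ≤ i ≤ n`, span the binary forms of degree `n`. -/
theorem homogeneousSubmodule_fin_two_eq_span (n : ℕ) :
    homogeneousSubmodule (Fin 2) K n =
      Submodule.span K (Set.range fun i : Fin (n + 1) ↦
        (X 0 ^ (n - (i : ℕ)) * X 1 ^ (i : ℕ) : MvPolynomial (Fin 2) K)) := by
  apply le_antisymm
  · intro f hf
    rw [← f.support_sum_monomial_coeff]
    refine Submodule.sum_mem _ fun m hm ↦ ?_
    have hdeg : m 0 + m 1 = n := by
      have := IsHomogeneous.degree_eq_sum_deg_support hf hm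
      rw [← Finsupp.degree_apply, Finsupp.degree_eq_sum, Fin.sum_univ_two] at this
      exact this.symm
    have hmon : monomial m (coeff m f) = coeff m f • (X 0 ^ m 0 * X 1 ^ m 1) := by
      rw [monomial_eq, Finsupp.prod_fintype _ _ (by simp), Fin.prod_univ_two, smul_eq_C_mul]
    rw [hmon]
    refine Submodule.smul_mem _ _ (Submodule.subset_span ⟨⟨m 1, by omega⟩, ?_⟩)
    simp [← hdeg]
  · rw [Submodule.span_le]
    rintro _ ⟨i, rfl⟩
    have h := (isHomogeneous_X_pow (R := K) (0 : Fin 2) (n - (i : ℕ))).mul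
      (isHomogeneous_X_pow (R := K) (1 : Fin 2) (i : ℕ))
    rwa [Nat.sub_add_cancel (Nat.lt_succ_iff.mp i.2)] at h

theorem linearIndependent_binary_monomials (n : ℕ) :
    LinearIndependent K fun i : Fin (n + 1) ↦
      (X 0 ^ (n - (i : ℕ)) * X 1 ^ (i : ℕ) : MvPolynomial (Fin 2) K) := by
  have hinj : Function.Injective fun i : Fin (n + 1) ↦
      (Finsupp.single 0 (n - (i : ℕ)) + Finsupp.single 1 (i : ℕ) : Fin 2 →₀ ℕ) := by
    intro i j h
    have := DFunLike.congr_fun h 1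
    exact Fin.ext (by simpa using this)
  have heq : (fun i : Fin (n + 1) ↦
      (X 0 ^ (n - (i : ℕ)) * X 1 ^ (i : ℕ) : MvPolynomial (Fin 2) K)) = _ :=
    funext fun i ↦ by simp only [X_pow_eq_monomial, monomial_mul, mul_one]; rfl
  rw [heq]
  exact (basisMonomials (Fin 2) K).linearIndependent.comp _ hinj

theorem finrank_homogeneousSubmodule_fin_two (n : ℕ) :
    Module.finrank K (homogeneousSubmodule (Fin 2) K n) = n + 1 := by
  rw [homogeneousSubmodule_fin_two_eq_span,
    finrank_span_eq_card (linearIndependent_binary_monomials n), Fintype.card_fin]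

instance finiteDimensional_homogeneousSubmodule (n : ℕ) :
    FiniteDimensional K (homogeneousSubmodule (Fin 2) K n) :=
  Module.Finite.iff_fg.mpr (homogeneousSubmodule_fg (Fin 2) K n)

theorem homogeneousSubmodule_pow (d k : ℕ) :
    homogeneousSubmodule (Fin 2) K d ^ k = homogeneousSubmodule (Fin 2) K (d * k) := by
  rw [← homogeneousSubmodule_one_pow K d, ← homogeneousSubmodule_one_pow K (d * k), pow_mul]

theorem pow_le_homogeneousSubmodule {L : Submodule K (MvPolynomial (Fin 2) K)} {d : ℕ}
    (hL : L ≤ homogeneousSubmodule (Fin 2) K d) (k : ℕ) :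
    L ^ k ≤ homogeneousSubmodule (Fin 2) K (d * k) :=
  (pow_le_pow_left' hL k).trans (homogeneousSubmodule_pow d k).le

/-- A nonzero form of degree `n` divisible by the `e`-th power of a linear form has a cofactor of
degree `n - e`. -/
theorem add_totalDegree_of_eq_lform_pow_mul {α : K} {n e : ℕ} {f q : MvPolynomial (Fin 2) K}
    (hf : f.IsHomogeneous n) (hf0 : f ≠ 0) (h : f = lform α 1 ^ e * q) :
    e + q.totalDegree = n := by
  have hq : q ≠ 0 := by
    rintro rfl
    exact hf0 (by simpa using h)
  have hl : lform α 1 ^ e ≠ 0 := pow_ne_zero e (lform_one_ne_zero α)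
  rw [← hf.totalDegree hf0, h, totalDegree_mul_of_isDomain hl hq,
    ((lform_isHomogeneous α 1).pow e).totalDegree hl, one_mul]

theorem le_of_lform_pow_dvd {α : K} {n e : ℕ} {f : MvPolynomial (Fin 2) K}
    (hf : f.IsHomogeneous n) (hf0 : f ≠ 0) (h : lform α 1 ^ e ∣ f) : e ≤ n := by
  obtain ⟨q, hq⟩ := h
  have := add_totalDegree_of_eq_lform_pow_mul hf hf0 hq
  omega

/-- A form of degree `n` divisible by the `n`-th power of a linear form is a multiple of it. -/
theorem lform_pow_mem_of_dvd {α : K} {n : ℕ} {f : MvPolynomial (Fin 2) K}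
    {W : Submodule K (MvPolynomial (Fin 2) K)} (hf : f.IsHomogeneous n) (hf0 : f ≠ 0)
    (hfW : f ∈ W) (h : lform α 1 ^ n ∣ f) : lform α 1 ^ n ∈ W := by
  obtain ⟨q, hq⟩ := h
  have hdeg := add_totalDegree_of_eq_lform_pow_mul hf hf0 hq
  rw [totalDegree_eq_zero_iff_eq_C.mp (show q.totalDegree = 0 by omega), mul_comm,
    ← smul_eq_C_mul] at hq
  have hc : coeff 0 q ≠ 0 := by
    intro hc
    exact hf0 (by rw [hq, hc, zero_smul])
  rw [hq] at hfW
  exact (Submodule.smul_mem_iff W hc).mp hfW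

/-- In characteristic zero, a proper space of binary forms of degree `n` contains only finitely
many `n`-th powers of the linear forms `s - αt`. -/
theorem finite_setOf_lform_pow_mem [CharZero K] {n : ℕ}
    {W : Submodule K (MvPolynomial (Fin 2) K)}
    (hW : ¬ homogeneousSubmodule (Fin 2) K n ≤ W) :
    {α : K | lform α 1 ^ n ∈ W}.Finite := by
  rw [homogeneousSubmodule_fin_two_eq_span, Submodule.span_le, Set.range_subset_iff] at hW
  push Not at hW
  obtain ⟨j, hj⟩ := hW
  obtain ⟨φ, hφj, hφW⟩ := Submodule.exists_le_ker_of_notMem hj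
  let c : ℕ → K := fun i ↦
    (-1) ^ i * φ (X 0 ^ (n - i) * X 1 ^ i) * (n.choose i : K)
  let p : Polynomial K := ∑ i ∈ Finset.range (n + 1), Polynomial.monomial i (c i)
  have hcoeff : p.coeff j = c j := by
    simp [p, Polynomial.finsetSum_coeff, Polynomial.coeff_monomial,
      (Nat.lt_succ_iff.mp j.2).not_gt]
  have hp : p ≠ 0 := by
    intro hp
    rw [hp, Polynomial.coeff_zero] at hcoeff
    refine mul_ne_zero (mul_ne_zero (by simp) hφj) ?_ hcoeff.symm
    exact_mod_cast (Nat.choose_pos (Nat.lt_succ_iff.mp j.2)).ne'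
  refine (Polynomial.finite_setOfPred_isRoot hp).subset fun α hα ↦ ?_
  have heval : p.eval α = φ (lform α 1 ^ n) := by
    have hexp : lform α 1 ^ n = ∑ i ∈ Finset.range (n + 1),
        ((-α) ^ i * (n.choose i : K)) • (X 0 ^ (n - i) * X 1 ^ i : MvPolynomial (Fin 2) K) := by
      rw [show lform α 1 = C (-α) * X 1 + X 0 by simp [lform]; ring, add_pow]
      refine Finset.sum_congr rfl fun i _ ↦ ?_
      rw [smul_eq_C_mul]
      simp only [map_mul, map_pow, map_natCast, mul_pow]
      ring
    rw [hexp, map_sum, Polynomial.eval_finsetSum]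
    refine Finset.sum_congr rfl fun i _ ↦ ?_
    rw [map_smul, smul_eq_mul, Polynomial.eval_monomial, neg_pow]
    simp only [c]
    ring
  have h0 : φ (lform α 1 ^ n) = 0 := hφW hα
  exact heval.trans h0

/-- A space of binary forms of degree `n` and dimension greater than `e` contains a nonzero form
vanishing to order at least `e` at any given point. -/
theorem exists_ne_zero_lform_pow_dvd (α : K) {n e : ℕ} (he : e ≤ n)
    {W : Submodule K (MvPolynomial (Fin 2) K)} (hW : W ≤ homogeneousSubmodule (Fin 2) K n)
    (hdim : e < Module.finrank K W) :
    ∃ f ∈ W, f ≠ 0 ∧ lform α 1 ^ e ∣ f := by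
  let V := (homogeneousSubmodule (Fin 2) K (n - e)).map
    (LinearMap.mulLeft K (lform α 1 ^ e))
  have hinj : Function.Injective (LinearMap.mulLeft K (lform α 1 ^ e)) :=
    mul_right_injective₀ (pow_ne_zero e (lform_one_ne_zero α))
  have hVdim : Module.finrank K V = n - e + 1 := by
    rw [← finrank_homogeneousSubmodule_fin_two (K := K) (n - e)]
    exact (Submodule.equivMapOfInjective _ hinj _).finrank_eq.symm
  have hV : V ≤ homogeneousSubmodule (Fin 2) K n := by
    rintro _ ⟨q, hq, rfl⟩
    have h := ((lform_isHomogeneous α 1).pow e).mul hq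
    rwa [one_mul, Nat.add_sub_cancel' he] at h
  have := Submodule.finiteDimensional_of_le hW
  have := Submodule.finiteDimensional_of_le hV
  have hsup := Submodule.finrank_mono (sup_le hW hV)
  rw [finrank_homogeneousSubmodule_fin_two] at hsup
  have hsum := Submodule.finrank_sup_add_finrank_inf_eq W V
  have hne : W ⊓ V ≠ ⊥ := by
    intro h
    rw [h, finrank_bot] at hsum
    omega
  obtain ⟨f, ⟨hfW, q, -, rfl⟩, hf0⟩ := Submodule.exists_mem_ne_zero_of_ne_bot hne
  exact ⟨_, hfW, hf0, Dvd.intro q rfl⟩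

/-- If no power `L ^ k`, `k ≥ 1`, contains the `dk`-th power of the linear form at `Q`, then a
finitely generated value semigroup at `Q` lies in a cone of slope strictly less than `d`. -/
theorem exists_bound_of_fg {L : Submodule K (MvPolynomial (Fin 2) K)} {d : ℕ}
    (hL : L ≤ homogeneousSubmodule (Fin 2) K d) {α : K}
    (hα : ∀ k : ℕ, 1 ≤ k → lform α 1 ^ (d * k) ∉ L ^ k)
    (hfg : (curveValueSemigroup L α 1).FG) :
    ∃ N : ℤ, 0 ≤ N ∧ ∀ p ∈ curveValueSemigroup L α 1, p.1 ≤ N * (d * p.1 - p.2) := by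
  have hgap : ∀ p ∈ curveValueSemigroup L α 1,
      (p.1 = 0 ∧ p.2 = 0) ∨ p.2 + 1 ≤ d * p.1 := by
    intro p hp
    induction hp using AddSubmonoid.closure_induction with
    | zero => simp
    | add p q _ _ hp hq =>
      simp only [Prod.fst_add, Prod.snd_add, mul_add]
      rcases hp with ⟨hp1, hp2⟩ | hp <;> rcases hq with ⟨hq1, hq2⟩ | hq
      · left; omega
      · right; rw [hp1, hp2]; omega
      · right; rw [hq1, hq2]; omega
      · right; omega
    | mem p hp =>
      obtain ⟨k, e, f, hf, hf0, hdvd, -, rfl⟩ := hp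
      have hhom : f.IsHomogeneous (d * k) := pow_le_homogeneousSubmodule hL k hf
      have hle := le_of_lform_pow_dvd hhom hf0 hdvd
      rcases Nat.eq_zero_or_pos k with rfl | hk
      · left
        simpa using hle
      · right
        have hne : e ≠ d * k := by
          rintro rfl
          exact hα k hk (lform_pow_mem_of_dvd hhom hf0 hf hdvd)
        have : e + 1 ≤ d * k := by omega
        simp only
        exact_mod_cast this
  obtain ⟨G, hG⟩ := hfg
  obtain ⟨N, hN⟩ := (G.image Prod.fst).bddAbove
  refine ⟨max N 0, le_max_right _ _, fun p hp ↦ ?_⟩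
  rw [← hG] at hp
  induction hp using AddSubmonoid.closure_induction with
  | zero => simp
  | add p q _ _ hp hq =>
    simp only [Prod.fst_add, Prod.snd_add]
    linarith
  | mem p hp =>
    have hpN : p.1 ≤ max N 0 :=
      (hN (Finset.mem_coe.mpr (Finset.mem_image_of_mem _ hp))).trans (le_max_left _ _)
    rcases hgap p (hG ▸ AddSubmonoid.subset_closure hp) with ⟨h1, h2⟩ | h
    · simp [h1, h2]
    · nlinarith [le_max_right N 0]

/-- A subspace whose powers eventually have dimension `dk + 1 - g` with `g ≥ 1` has no positive
power equal to the full space of forms. -/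
theorem not_homogeneousSubmodule_le_pow {L : Submodule K (MvPolynomial (Fin 2) K)} {d : ℕ}
    (hL : L ≤ homogeneousSubmodule (Fin 2) K d) {g : ℤ} (hg : 1 ≤ g)
    (hdeg : ∀ᶠ k : ℕ in atTop, (Module.finrank K ↥(L ^ k) : ℤ) = d * k + 1 - g)
    {k : ℕ} (hk : 1 ≤ k) : ¬ homogeneousSubmodule (Fin 2) K (d * k) ≤ L ^ k := by
  intro h
  obtain ⟨M, hM⟩ := eventually_atTop.mp hdeg
  have heq := (pow_le_homogeneousSubmodule hL k).antisymm h
  have hpow : L ^ (k * M) = homogeneousSubmodule (Fin 2) K (d * (k * M)) := by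
    rw [pow_mul, heq, homogeneousSubmodule_pow, mul_assoc]
  have hfin := hM (k * M) (Nat.le_mul_of_pos_left M hk)
  rw [hpow, finrank_homogeneousSubmodule_fin_two] at hfin
  push_cast at hfin
  linarith

/-- **Theorem 4.11, converse part.** Let `K` be an uncountable algebraically closed field of
characteristic `0` and `L ⊆ Sym^d` a subspace of dimension at least `3`, of degree `d` and
arithmetic genus `g ≥ 1`. Then `R(L)` is not homogeneously Khovanskii-finite: there is a
point `Q = (α : β)` of `ℙ¹` whose value semigroup `S(L, Q)` is not finitely generated. -/
theorem not_khovanskiiFinite_of_genus_ge_one [IsAlgClosed K] [Uncountable K] [CharZero K]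
    (d : ℕ) (hd : 1 ≤ d)
    (L : Submodule K (MvPolynomial (Fin 2) K))
    (hL : L ≤ MvPolynomial.homogeneousSubmodule (Fin 2) K d)
    (hdim : 3 ≤ Module.finrank K ↥L)
    (g : ℤ) (hg : 1 ≤ g)
    -- `L` has degree `d` and arithmetic genus `g`
    (hdeg : ∀ᶠ k : ℕ in atTop, (Module.finrank K ↥(L ^ k) : ℤ) = d * k + 1 - g) :
    ∃ α β : K, (α, β) ≠ ((0 : K), (0 : K)) ∧ ¬ (curveValueSemigroup L α β).FG := by
  have hcount : (⋃ k : ℕ, {α : K | 1 ≤ k ∧ lform α 1 ^ (d * k) ∈ L ^ k}).Countable := by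
    refine Set.countable_iUnion fun k ↦ ?_
    by_cases hk : 1 ≤ k
    · simpa [hk] using
        (finite_setOf_lform_pow_mem (not_homogeneousSubmodule_le_pow hL hg hdeg hk)).countable
    · simp [hk]
  obtain ⟨α, hα⟩ : ∃ α : K, α ∉ ⋃ k : ℕ, {α : K | 1 ≤ k ∧ lform α 1 ^ (d * k) ∈ L ^ k} := by
    by_contra! h
    exact Set.not_countable_univ (hcount.mono fun α _ ↦ h α)
  simp only [Set.mem_iUnion, Set.mem_ofPred_eq, not_exists, not_and] at hα
  refine ⟨α, 1, by simp, fun hfg ↦ ?_⟩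
  obtain ⟨N, hN0, hN⟩ := exists_bound_of_fg hL hα hfg
  obtain ⟨M, hM⟩ := eventually_atTop.mp hdeg
  lift g to ℕ using by omega
  lift N to ℕ using hN0
  let k := M + g + N * g + 1
  have hgk : g ≤ d * k :=
    (show g ≤ k by simp only [k]; omega).trans (Nat.le_mul_of_pos_left k hd)
  have hfin := hM k (by simp only [k]; omega)
  have hlt : d * k - g < Module.finrank K ↥(L ^ k) := by
    zify [hgk]
    linarith
  obtain ⟨f, hf, hf0, hdvd⟩ := exists_ne_zero_lform_pow_dvd α (Nat.sub_le _ _)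
    (pow_le_homogeneousSubmodule hL k) hlt
  have hmult : FiniteMultiplicity (lform α 1) f := by
    refine ⟨d * k, fun h ↦ ?_⟩
    have := le_of_lform_pow_dvd (pow_le_homogeneousSubmodule hL k hf) hf0 h
    omega
  have hmem : ((k : ℤ), (multiplicity (lform α 1) f : ℤ)) ∈ curveValueSemigroup L α 1 :=
    AddSubmonoid.subset_closure ⟨k, _, f, hf, hf0, pow_multiplicity_dvd _ _,
      hmult.not_pow_dvd_of_multiplicity_lt (Nat.lt_succ_self _), rfl⟩
  have hbound : (k : ℤ) ≤ _ := hN _ hmem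
  have hle : d * k ≤ multiplicity (lform α 1) f + g := by
    have := hmult.pow_dvd_iff_le_multiplicity.mp hdvd
    omega
  have hle' : (d : ℤ) * k - multiplicity (lform α 1) f ≤ g := by
    have : (d : ℤ) * k ≤ multiplicity (lform α 1) f + g := by exact_mod_cast hle
    linarith
  have hNg := hbound.trans (mul_le_mul_of_nonneg_left hle' (Int.natCast_nonneg N))
  have : k ≤ N * g := by exact_mod_cast hNg
  simp only [k] at this
  omega

end
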